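/- Let E₁, E₂ be real finite-dimensional inner product spaces and 0 < μ_g ≤ L_{g,1}; set κ_g := L_{g,1}/μ_g. For t ∈ {t−1, t}, let g_s : E₁ × E₂ → ℝ be such that for every x the function g_s(x,·) is differentiable and μ_g-strongly convex with unique minimizer y*_s(x), its gradient map y ↦ ∇_y g_s(x,y) is L_{g,1}-Lipschitz, and the minimizer map x ↦ y*_s(x) is κ_g-Lipschitz. Let 0 < α ≤ 1/L_{g,1}, let x_{t−1}, x_t ∈ E₁ and y_t ∈ E₂, and set y_{t+1} := y_t − α ∇_y g_t(x_t, y_t). Then ‖y_{t+1} − y*_t(x_t)‖² ≤ (1 − αμ_gL_{g,1}/(μ_g + L_{g,1}))·‖y_t − y*_{t−1}(x_{t−1})‖² − (2α/(μ_g + L_{g,1}) − α²)·‖∇_y g_t(x_t, y_t)‖² + 2(1 − 2αμ_gL_{g,1}/(μ_g + L_{g,1}))(1 + (μ_g + L_{g,1})/(αμ_gL_{g,1}))·(‖y*_{t−1}(x_{t−1}) − y*_t(x_{t−1})‖² + κ_g²‖x_t − x_{t−1}‖²). -/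

import Mathlib

open scoped InnerProductSpace

section Aux
variable {E : Type*} [NormedAddCommGroup E] [InnerProductSpace ℝ E] [CompleteSpace E]

lemma aux_line {f : E → ℝ} {f' : E → E} (hf : ∀ y, HasGradientAt f (f' y) y) (x v : E) (t : ℝ) :
    HasDerivAt (fun t : ℝ => f (x + t • v)) ⟪f' (x + t • v), v⟫_ℝ t := by
  have h1 : HasDerivAt (fun t : ℝ => x + t • v) v t := by
    simpa using ((hasDerivAt_id t).smul_const v).const_add x
  have h2 := (hf (x + t • v)).hasFDerivAt.comp_hasDerivAt t h1
  simpa [Function.comp_def] using h2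

lemma aux_descent {f : E → ℝ} {f' : E → E} (hf : ∀ y, HasGradientAt f (f' y) y) {L : ℝ}
    (hL : ∀ y y', ‖f' y - f' y'‖ ≤ L * ‖y - y'‖) (x v : E) :
    f (x + v) ≤ f x + ⟪f' x, v⟫_ℝ + L / 2 * ‖v‖ ^ 2 := by
  have hd : ∀ t : ℝ, HasDerivAt
      (fun t : ℝ => f (x + t • v) - t * ⟪f' x, v⟫_ℝ - t ^ 2 * (L / 2 * ‖v‖ ^ 2))
      (⟪f' (x + t • v), v⟫_ℝ - ⟪f' x, v⟫_ℝ - 2 * t * (L / 2 * ‖v‖ ^ 2)) t := by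
    intro t
    have h1 := (hasDerivAt_id t).mul_const ⟪f' x, v⟫_ℝ
    have h2 := (hasDerivAt_pow 2 t).mul_const (L / 2 * ‖v‖ ^ 2)
    have h3 := ((aux_line hf x v t).sub h1).sub h2
    simpa [Pi.sub_def] using h3
  have hanti : AntitoneOn
      (fun t : ℝ => f (x + t • v) - t * ⟪f' x, v⟫_ℝ - t ^ 2 * (L / 2 * ‖v‖ ^ 2))
      (Set.Icc 0 1) := by
    apply antitoneOn_of_deriv_nonpos (convex_Icc 0 1)
    · exact fun t _ => (hd t).continuousAt.continuousWithinAt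
    · exact fun t _ => (hd t).differentiableAt.differentiableWithinAt
    · intro t ht
      rw [interior_Icc] at ht
      rw [(hd t).deriv, ← inner_sub_left]
      have h1 := real_inner_le_norm (f' (x + t • v) - f' x) v
      have h2 := hL (x + t • v) x
      rw [add_sub_cancel_left, norm_smul, Real.norm_of_nonneg ht.1.le] at h2
      have h3 := mul_le_mul_of_nonneg_right h2 (norm_nonneg v)
      nlinarith
  have h := hanti (Set.left_mem_Icc.2 zero_le_one) (Set.right_mem_Icc.2 zero_le_one) zero_le_one
  simp at h
  linarith

lemma aux_lower {f : E → ℝ} {f' : E → E} (hf : ∀ y, HasGradientAt f (f' y) y) {m : ℝ}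
    (hc : StrongConvexOn Set.univ m f) (x v : E) :
    f x + ⟪f' x, v⟫_ℝ + m / 2 * ‖v‖ ^ 2 ≤ f (x + v) := by
  rw [strongConvexOn_iff_convex] at hc
  have hexp : ∀ t : ℝ, ‖x + t • v‖ ^ 2 = ‖x‖ ^ 2 + t * (2 * ⟪x, v⟫_ℝ) + t ^ 2 * ‖v‖ ^ 2 := by
    intro t
    rw [norm_add_sq_real, inner_smul_right, norm_smul, mul_pow, Real.norm_eq_abs, sq_abs]
    ring
  have hc2 : ConvexOn ℝ Set.univ (fun t : ℝ => f (x + t • v) - m / 2 * ‖x + t • v‖ ^ 2) := by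
    refine ⟨convex_univ, fun a _ b _ p q hp hq hpq => ?_⟩
    have h := hc.2 (Set.mem_univ (x + a • v)) (Set.mem_univ (x + b • v)) hp hq hpq
    have e : p • (x + a • v) + q • (x + b • v) = x + (p • a + q • b) • v := by
      have : x = (p + q) • x := by rw [hpq, one_smul]
      conv_rhs => rw [this]
      simp only [smul_eq_mul]
      module
    rw [e] at h
    exact h
  have hd : HasDerivAt (fun t : ℝ => f (x + t • v) - m / 2 * ‖x + t • v‖ ^ 2)
      (⟪f' x, v⟫_ℝ - m / 2 * (2 * ⟪x, v⟫_ℝ)) 0 := by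
    simp only [hexp]
    have h1 := (hasDerivAt_id (0 : ℝ)).mul_const (2 * ⟪x, v⟫_ℝ)
    have h2 := (hasDerivAt_pow 2 (0 : ℝ)).mul_const (‖v‖ ^ 2)
    have h3 := (aux_line hf x v 0).sub (((h1.const_add (‖x‖ ^ 2)).add h2).const_mul (m / 2))
    simpa [Pi.sub_def, Pi.add_def] using h3
  have h := hc2.le_slope_of_hasDerivAt (Set.mem_univ 0) (Set.mem_univ 1) zero_lt_one hd
  rw [slope_def_field] at h
  simp only [hexp] at h
  simp at h
  linarith

lemma aux_coercive {f : E → ℝ} {f' : E → E} (hf : ∀ y, HasGradientAt f (f' y) y) {m L : ℝ}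
    (hmL : m ≤ L) (hc : StrongConvexOn Set.univ m f)
    (hL : ∀ y y', ‖f' y - f' y'‖ ≤ L * ‖y - y'‖) (x y : E) :
    m * L * ‖x - y‖ ^ 2 + ‖f' x - f' y‖ ^ 2 ≤ (m + L) * ⟪f' x - f' y, x - y⟫_ℝ := by
  obtain ⟨D, hD⟩ : ∃ D, D = x - y := ⟨_, rfl⟩
  obtain ⟨G, hG⟩ : ∃ G, G = f' x - f' y := ⟨_, rfl⟩
  have key : ∀ u : E, 2 * ⟪G - m • D, u⟫_ℝ - (L - m) * ‖u‖ ^ 2 ≤ ⟪G - m • D, D⟫_ℝ := by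
    intro u
    have h1 := aux_lower hf hc x (u - D)
    have h2 := aux_descent hf hL y u
    have h3 := aux_lower hf hc y (D - u)
    have h4 := aux_descent hf hL x (-u)
    have e1 : x + (u - D) = y + u := by rw [hD]; abel
    have e2 : y + (D - u) = x + -u := by rw [hD]; abel
    rw [e1] at h1
    rw [e2] at h3
    have n1 : ‖u - D‖ ^ 2 = ‖u‖ ^ 2 - 2 * ⟪D, u⟫_ℝ + ‖D‖ ^ 2 := by
      rw [norm_sub_sq_real, real_inner_comm]
    rw [norm_sub_rev D u, n1] at h3
    rw [n1] at h1
    rw [norm_neg] at h4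
    have i1 : ⟪G, u⟫_ℝ = ⟪f' x, u⟫_ℝ - ⟪f' y, u⟫_ℝ := by rw [hG, inner_sub_left]
    have i2 : ⟪G, D⟫_ℝ = ⟪f' x, D⟫_ℝ - ⟪f' y, D⟫_ℝ := by rw [hG, inner_sub_left]
    simp only [inner_sub_right, inner_neg_right] at h1 h2 h3 h4
    simp only [inner_sub_left, real_inner_smul_left, real_inner_self_eq_norm_sq]
    linarith
  rw [← hD, ← hG]
  obtain ⟨H, hH⟩ : ∃ H, H = G - m • D := ⟨_, rfl⟩
  rw [← hH] at key
  have hs : ∀ s : ℝ, 2 * s * ‖H‖ ^ 2 - (L - m) * (s ^ 2 * ‖H‖ ^ 2) ≤ ⟪H, D⟫_ℝ := by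
    intro s
    have := key (s • H)
    rw [inner_smul_right, real_inner_self_eq_norm_sq, norm_smul, mul_pow, Real.norm_eq_abs,
      sq_abs] at this
    linarith
  have hfin : ‖H‖ ^ 2 ≤ (L - m) * ⟪H, D⟫_ℝ := by
    rcases hmL.eq_or_lt with h | h
    · subst h
      by_contra! hn
      simp only [sub_self, zero_mul] at hn hs
      have := hs ((⟪H, D⟫_ℝ + 1) / (2 * ‖H‖ ^ 2))
      have e : 2 * ((⟪H, D⟫_ℝ + 1) / (2 * ‖H‖ ^ 2)) * ‖H‖ ^ 2 = ⟪H, D⟫_ℝ + 1 := by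
        have hne : ‖H‖ ≠ 0 := fun h0 => by simp [h0] at hn
        field_simp
      linarith
    · have hp : 0 < L - m := sub_pos.2 h
      have := mul_le_mul_of_nonneg_left (hs (1 / (L - m))) hp.le
      have e : (L - m) * (2 * (1 / (L - m)) * ‖H‖ ^ 2 -
          (L - m) * ((1 / (L - m)) ^ 2 * ‖H‖ ^ 2)) = ‖H‖ ^ 2 := by
        field_simp
        ring
      linarith
  have hGe : G = H + m • D := by rw [hH]; abel
  have n1 : ‖G‖ ^ 2 = ‖H‖ ^ 2 + 2 * (m * ⟪H, D⟫_ℝ) + m ^ 2 * ‖D‖ ^ 2 := by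
    rw [hGe, norm_add_sq_real, inner_smul_right, norm_smul, mul_pow, Real.norm_eq_abs, sq_abs]
  have n2 : ⟪G, D⟫_ℝ = ⟪H, D⟫_ℝ + m * ‖D‖ ^ 2 := by
    rw [hGe, inner_add_left, real_inner_smul_left, real_inner_self_eq_norm_sq]
  rw [n1, n2]
  linarith

end Aux

/-- One inner gradient-descent step of the fully single-loop method (Lemma A.5):
with `y_{t+1} = y_t − α∇_y g_t(x_t, y_t)`, the squared distance to the current inner
optimum is controlled by the previous tracking error, the gradient norm, the drift of
the inner optimum and the movement of the outer iterate. The index `0` plays the role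
of time `t−1` and the index `1` the role of time `t`. -/
theorem single_loop_inner_step {E₁ E₂ : Type*}
    [NormedAddCommGroup E₁] [InnerProductSpace ℝ E₁] [FiniteDimensional ℝ E₁]
    [NormedAddCommGroup E₂] [InnerProductSpace ℝ E₂] [FiniteDimensional ℝ E₂]
    (μ_g L_g1 : ℝ) (hμ : 0 < μ_g) (hμL : μ_g ≤ L_g1)
    (κ_g : ℝ) (hκg : κ_g = L_g1 / μ_g)
    (g : Fin 2 → E₁ → E₂ → ℝ) (gy : Fin 2 → E₁ → E₂ → E₂) (ys : Fin 2 → E₁ → E₂)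
    (hgrad : ∀ (s : Fin 2) (x : E₁) (y : E₂), HasGradientAt (g s x) (gy s x y) y)
    (hsc : ∀ (s : Fin 2) (x : E₁), StrongConvexOn Set.univ μ_g (g s x))
    (hmin : ∀ (s : Fin 2) (x : E₁) (y : E₂), g s x (ys s x) ≤ g s x y)
    (hgylip : ∀ (s : Fin 2) (x : E₁) (y y' : E₂),
      ‖gy s x y - gy s x y'‖ ≤ L_g1 * ‖y - y'‖)
    (hyslip : ∀ (s : Fin 2) (x x' : E₁), ‖ys s x - ys s x'‖ ≤ κ_g * ‖x - x'‖)
    (α : ℝ) (hα : 0 < α) (hα' : α ≤ 1 / L_g1)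
    (xprev xcur : E₁) (ycur : E₂) :
    ‖(ycur - α • gy 1 xcur ycur) - ys 1 xcur‖ ^ 2 ≤
      (1 - α * μ_g * L_g1 / (μ_g + L_g1)) * ‖ycur - ys 0 xprev‖ ^ 2 -
      (2 * α / (μ_g + L_g1) - α ^ 2) * ‖gy 1 xcur ycur‖ ^ 2 +
      2 * (1 - 2 * α * μ_g * L_g1 / (μ_g + L_g1)) *
        (1 + (μ_g + L_g1) / (α * μ_g * L_g1)) *
        (‖ys 0 xprev - ys 1 xprev‖ ^ 2 + κ_g ^ 2 * ‖xcur - xprev‖ ^ 2) := by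
  have hL : 0 < L_g1 := lt_of_lt_of_le hμ hμL
  have hgs : gy 1 xcur (ys 1 xcur) = 0 := by
    have hm : IsLocalMin (g 1 xcur) (ys 1 xcur) := Filter.Eventually.of_forall (hmin 1 xcur)
    have := hm.hasFDerivAt_eq_zero (hgrad 1 xcur (ys 1 xcur)).hasFDerivAt
    simpa using this
  have hco := aux_coercive (hgrad 1 xcur) hμL (hsc 1 xcur) (hgylip 1 xcur) ycur (ys 1 xcur)
  rw [hgs, sub_zero] at hco
  have hS : 0 < μ_g + L_g1 := by positivity
  obtain ⟨G, hG⟩ : ∃ G, G = gy 1 xcur ycur := ⟨_, rfl⟩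
  obtain ⟨c, hc⟩ : ∃ c, c = α * μ_g * L_g1 / (μ_g + L_g1) := ⟨_, rfl⟩
  have hc0 : 0 < c := by rw [hc]; positivity
  have hc1 : 2 * c ≤ 1 := by
    have h1 : α * L_g1 ≤ 1 := by rwa [le_div_iff₀ hL] at hα'
    rw [hc, ← mul_div_assoc, div_le_one hS]
    nlinarith
  have e1 : 2 * α * μ_g * L_g1 / (μ_g + L_g1) = 2 * c := by rw [hc]; ring
  have e2 : (μ_g + L_g1) / (α * μ_g * L_g1) = 1 / c := by rw [hc, one_div_div]
  rw [e1, e2, ← hc, ← hG]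
  rw [← hG] at hco
  have hstep : ‖(ycur - α • G) - ys 1 xcur‖ ^ 2 ≤ (1 - 2 * c) * ‖ycur - ys 1 xcur‖ ^ 2
      - (2 * α / (μ_g + L_g1) - α ^ 2) * ‖G‖ ^ 2 := by
    have e : (ycur - α • G) - ys 1 xcur = (ycur - ys 1 xcur) - α • G := by abel
    rw [e, norm_sub_sq_real, inner_smul_right, norm_smul, mul_pow, Real.norm_eq_abs, sq_abs,
      real_inner_comm]
    have h := mul_le_mul_of_nonneg_left hco (show 0 ≤ 2 * α / (μ_g + L_g1) by positivity)
    have h1 : 2 * α / (μ_g + L_g1) * ((μ_g + L_g1) * ⟪G, ycur - ys 1 xcur⟫_ℝ)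
        = 2 * α * ⟪G, ycur - ys 1 xcur⟫_ℝ := by field_simp
    have h2 : 2 * α / (μ_g + L_g1) * (μ_g * L_g1 * ‖ycur - ys 1 xcur‖ ^ 2 + ‖G‖ ^ 2)
        = 2 * c * ‖ycur - ys 1 xcur‖ ^ 2 + 2 * α / (μ_g + L_g1) * ‖G‖ ^ 2 := by rw [hc]; ring
    rw [h1, h2] at h
    linarith
  have hA : ‖ycur - ys 1 xcur‖ ≤ ‖ycur - ys 0 xprev‖ +
      (‖ys 0 xprev - ys 1 xprev‖ + κ_g * ‖xcur - xprev‖) := by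
    have t1 := norm_sub_le_norm_sub_add_norm_sub ycur (ys 0 xprev) (ys 1 xcur)
    have t2 := norm_sub_le_norm_sub_add_norm_sub (ys 0 xprev) (ys 1 xprev) (ys 1 xcur)
    have t3 := hyslip 1 xprev xcur
    rw [norm_sub_rev xprev xcur] at t3
    linarith
  have hy : ‖ycur - ys 1 xcur‖ ^ 2 ≤ (1 + c) * ‖ycur - ys 0 xprev‖ ^ 2 +
      (1 + 1 / c) * (2 * (‖ys 0 xprev - ys 1 xprev‖ ^ 2 + κ_g ^ 2 * ‖xcur - xprev‖ ^ 2)) := by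
    generalize ‖ycur - ys 0 xprev‖ = a at *
    generalize ‖ys 0 xprev - ys 1 xprev‖ = b at *
    generalize ‖xcur - xprev‖ = d at *
    have h1 : ‖ycur - ys 1 xcur‖ ^ 2 ≤ (a + (b + κ_g * d)) ^ 2 :=
      pow_le_pow_left₀ (norm_nonneg _) hA 2
    have h2 : (a + (b + κ_g * d)) ^ 2 ≤ (1 + c) * a ^ 2 + (1 + 1 / c) * (b + κ_g * d) ^ 2 := by
      have h3 : 0 ≤ (c * a - (b + κ_g * d)) ^ 2 / c := by positivity
      have h4 : (c * a - (b + κ_g * d)) ^ 2 / c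
          = c * a ^ 2 - 2 * a * (b + κ_g * d) + 1 / c * (b + κ_g * d) ^ 2 := by
        field_simp
        ring
      linarith
    have h5 : (1 + 1 / c) * (b + κ_g * d) ^ 2 ≤ (1 + 1 / c) * (2 * (b ^ 2 + κ_g ^ 2 * d ^ 2)) := by
      apply mul_le_mul_of_nonneg_left _ (by positivity)
      linarith [sq_nonneg (b - κ_g * d)]
    linarith
  have h6 := mul_le_mul_of_nonneg_left hy (sub_nonneg.2 hc1)
  have h7 : 0 ≤ c ^ 2 * ‖ycur - ys 0 xprev‖ ^ 2 := by positivity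
  linarith
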